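/- arXiv:2512.12350 — 2 statements merged into one kernel-verified Lean document; each statement's English description precedes it below -/
import Mathlib

section
/- Let A be a Hopf algebra over a field k whose antipode S is bijective, and let h ∈ A be a nonzero element that is simultaneously a left cointegral and a right cointegral. Let φ : A → k be a left-invariant functional with φ(h) = 1 and ψ : A → k a right-invariant functional with ψ(h) = 1. Then for all a, b ∈ A one has φ(a·b) = φ(b·S²(a)) and ψ(a·b) = ψ(b·S⁻²(a)). -/
open Coalgebra HopfAlgebra TensorProduct

section aux
variable {k A : Type*} [Field k] [Ring A] [HopfAlgebra k A]

lemma aux_conv_left (a : A) :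
    (TensorProduct.lift ((LinearMap.mul k (A ⊗[k] A)).comp
      (((TensorProduct.mk k A A).flip 1).comp (antipode k))))
      (comul.lTensor A (comul (R := k) a)) = (1 : A) ⊗ₜ[k] a := by
  set F := (TensorProduct.lift ((LinearMap.mul k (A ⊗[k] A)).comp
      (((TensorProduct.mk k A A).flip 1).comp (antipode (A := A) k)))) with hF
  have h1 : ∀ t : A ⊗[k] A, F (TensorProduct.assoc k A A A (comul.rTensor A t))
      = (TensorProduct.mk k A A 1) (TensorProduct.lid k A (counit.rTensor A t)) := by
    intro t
    induction t with
    | zero => simp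
    | add x y hx hy => simp only [map_add, hx, hy]
    | tmul x z =>
      have h2 : ∀ u : A ⊗[k] A, F (TensorProduct.assoc k A A A (u ⊗ₜ z))
          = (LinearMap.mul' k A ((antipode k).rTensor A u)) ⊗ₜ[k] z := by
        intro u
        induction u with
        | zero => simp
        | add x y hx hy => simp only [map_add, TensorProduct.add_tmul, hx, hy]
        | tmul x y => simp [hF]
      simp only [LinearMap.rTensor_tmul, h2, mul_antipode_rTensor_comul_apply]
      simp [Algebra.algebraMap_eq_smul_one, TensorProduct.smul_tmul]
  rw [← coassoc_apply, h1]
  simp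

lemma aux_conv_right (a : A) :
    (TensorProduct.lift ((LinearMap.mul k (A ⊗[k] A)).compl₂
      ((TensorProduct.mk k A A 1).comp (antipode k))))
      (comul.rTensor A (comul (R := k) a)) = a ⊗ₜ[k] (1 : A) := by
  set F := (TensorProduct.lift ((LinearMap.mul k (A ⊗[k] A)).compl₂
      ((TensorProduct.mk k A A 1).comp (antipode (A := A) k)))) with hF
  have h1 : ∀ t : A ⊗[k] A, F ((TensorProduct.assoc k A A A).symm (comul.lTensor A t))
      = ((TensorProduct.mk k A A).flip 1) (TensorProduct.rid k A (counit.lTensor A t)) := by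
    intro t
    induction t with
    | zero => simp
    | add x y hx hy => simp only [map_add, hx, hy]
    | tmul z x =>
      have h2 : ∀ u : A ⊗[k] A, F ((TensorProduct.assoc k A A A).symm (z ⊗ₜ u))
          = z ⊗ₜ[k] (LinearMap.mul' k A ((antipode k).lTensor A u)) := by
        intro u
        induction u with
        | zero => simp
        | add x y hx hy => simp only [map_add, TensorProduct.tmul_add, hx, hy]
        | tmul x y => simp [hF]
      simp only [LinearMap.lTensor_tmul, h2, mul_antipode_lTensor_comul_apply]
      simp [Algebra.algebraMap_eq_smul_one, TensorProduct.smul_tmul]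
  rw [← coassoc_symm_apply, h1]
  simp

lemma aux_left (h : A) (hleft : ∀ a : A, a * h = counit (R := k) a • h) (a : A) :
    ((1 : A) ⊗ₜ[k] a) * comul (R := k) h = (antipode k a ⊗ₜ[k] (1 : A)) * comul (R := k) h := by
  rw [← aux_conv_left a]
  have key : ∀ t : A ⊗[k] A, (TensorProduct.lift ((LinearMap.mul k (A ⊗[k] A)).comp
      (((TensorProduct.mk k A A).flip 1).comp (antipode k))))
      (comul.lTensor A t) * comul (R := k) h
      = (antipode k (TensorProduct.rid k A (counit.lTensor A t)) ⊗ₜ[k] (1 : A))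
        * comul (R := k) h := by
    intro t
    induction t with
    | zero => simp
    | add x y hx hy => simp only [map_add, TensorProduct.add_tmul, add_mul, hx, hy]
    | tmul x y =>
      simp only [LinearMap.lTensor_tmul, TensorProduct.lift.tmul, LinearMap.comp_apply,
        LinearMap.mul_apply', mul_assoc]
      rw [← Bialgebra.comul_mul, hleft]
      simp [← TensorProduct.smul_tmul']
  rw [key]
  simp

lemma aux_right (h : A) (hright : ∀ a : A, h * a = counit (R := k) a • h) (a : A) :
    comul (R := k) h * (a ⊗ₜ[k] (1 : A)) = comul (R := k) h * ((1 : A) ⊗ₜ[k] antipode k a) := by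
  rw [← aux_conv_right a]
  have key : ∀ t : A ⊗[k] A, comul (R := k) h *
      (TensorProduct.lift ((LinearMap.mul k (A ⊗[k] A)).compl₂
      ((TensorProduct.mk k A A 1).comp (antipode k)))) (comul.rTensor A t)
      = comul (R := k) h *
        ((1 : A) ⊗ₜ[k] antipode k (TensorProduct.lid k A (counit.rTensor A t))) := by
    intro t
    induction t with
    | zero => simp
    | add x y hx hy => simp only [map_add, TensorProduct.tmul_add, mul_add, hx, hy]
    | tmul x y =>
      simp only [LinearMap.rTensor_tmul, TensorProduct.lift.tmul, LinearMap.compl₂_apply,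
        LinearMap.comp_apply, LinearMap.mul_apply']
      rw [← mul_assoc, ← Bialgebra.comul_mul, hright]
      simp
  rw [key]
  simp

end aux


/-- If the antipode `S` of a Hopf algebra `A` over a field `k` is bijective,
`h` is a nonzero two-sided cointegral, `φ` is left invariant with `φ h = 1` and `ψ` is right
invariant with `ψ h = 1`, then `φ(a·b) = φ(b·S²(a))` and `ψ(a·b) = ψ(b·S⁻²(a))` for all
`a, b ∈ A`. -/
theorem stmt11 {k A : Type*} [Field k] [Ring A] [HopfAlgebra k A]
    (hS : Function.Bijective (antipode (R := k) (A := A)))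
    (h : A) (hh : h ≠ 0)
    (hleft : ∀ a : A, a * h = counit (R := k) a • h)
    (hright : ∀ a : A, h * a = counit (R := k) a • h)
    (φ ψ : A →ₗ[k] k) (hφh : φ h = 1) (hψh : ψ h = 1)
    (hφ : ∀ a : A,
      (TensorProduct.rid k A) ((LinearMap.lTensor A φ) (comul (R := k) a)) = φ a • (1 : A))
    (hψ : ∀ a : A,
      (TensorProduct.lid k A) ((LinearMap.rTensor A ψ) (comul (R := k) a)) = ψ a • (1 : A)) :
    ∀ a b : A,
      φ (a * b) = φ (b * antipode (R := k) (antipode (R := k) a)) ∧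
      ψ (a * b) = ψ (b * Function.invFun (antipode (R := k) (A := A))
        (Function.invFun (antipode (R := k) (A := A)) a)) := by
  have lm : ∀ (f : A →ₗ[k] k) (x y : A) (t : A ⊗[k] A),
      TensorProduct.lid k A (f.rTensor A ((x ⊗ₜ[k] (1 : A)) * t * (y ⊗ₜ[k] (1 : A))))
      = TensorProduct.lid k A
        ((f ∘ₗ LinearMap.mulLeft k x ∘ₗ LinearMap.mulRight k y).rTensor A t) := by
    intro f x y t
    induction t with
    | zero => simp
    | add u v hu hv => simp only [map_add, mul_add, add_mul, hu, hv]
    | tmul u v => simp [mul_assoc]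
  have lm' : ∀ (f : A →ₗ[k] k) (x y : A) (t : A ⊗[k] A),
      TensorProduct.lid k A (f.rTensor A (((1 : A) ⊗ₜ[k] x) * t * ((1 : A) ⊗ₜ[k] y)))
      = x * TensorProduct.lid k A (f.rTensor A t) * y := by
    intro f x y t
    induction t with
    | zero => simp
    | add u v hu hv => simp only [map_add, mul_add, add_mul, hu, hv]
    | tmul u v => simp
  have rm : ∀ (f : A →ₗ[k] k) (x y : A) (t : A ⊗[k] A),
      TensorProduct.rid k A (f.lTensor A (((1 : A) ⊗ₜ[k] x) * t * ((1 : A) ⊗ₜ[k] y)))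
      = TensorProduct.rid k A
        ((f ∘ₗ LinearMap.mulLeft k x ∘ₗ LinearMap.mulRight k y).lTensor A t) := by
    intro f x y t
    induction t with
    | zero => simp
    | add u v hu hv => simp only [map_add, mul_add, add_mul, hu, hv]
    | tmul u v => simp [mul_assoc]
  have rm' : ∀ (f : A →ₗ[k] k) (x y : A) (t : A ⊗[k] A),
      TensorProduct.rid k A (f.lTensor A ((x ⊗ₜ[k] (1 : A)) * t * (y ⊗ₜ[k] (1 : A))))
      = x * TensorProduct.rid k A (f.lTensor A t) * y := by
    intro f x y t
    induction t with
    | zero => simp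
    | add u v hu hv => simp only [map_add, mul_add, add_mul, hu, hv]
    | tmul u v => simp
  -- swapping the two slices
  have sw : ∀ (f g : A →ₗ[k] k) (t : A ⊗[k] A),
      f (TensorProduct.rid k A (g.lTensor A t)) = g (TensorProduct.lid k A (f.rTensor A t)) := by
    intro f g t
    induction t with
    | zero => simp
    | add u v hu hv => simp only [map_add, hu, hv]
    | tmul u v => simp [mul_comm]
  have one_eq : (1 : A ⊗[k] A) = (1 : A) ⊗ₜ[k] (1 : A) := rfl
  have e1 : ∀ a : A, TensorProduct.rid k A ((φ ∘ₗ LinearMap.mulLeft k a).lTensor A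
      (comul (R := k) h)) = antipode k a := by
    intro a
    have h1 := rm φ a 1 (comul (R := k) h)
    have h2 := rm' φ (antipode k a) 1 (comul (R := k) h)
    rw [← one_eq, mul_one] at h1 h2
    rw [aux_left h hleft, h2, hφ, hφh] at h1
    simpa using h1.symm
  have e2 : ∀ a : A, TensorProduct.rid k A
      ((φ ∘ₗ LinearMap.mulRight k (antipode k a)).lTensor A (comul (R := k) h)) = a := by
    intro a
    have h1 := rm φ 1 (antipode k a) (comul (R := k) h)
    have h2 := rm' φ 1 a (comul (R := k) h)
    rw [← one_eq, one_mul] at h1 h2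
    rw [← aux_right h hright, h2, hφ, hφh] at h1
    simpa using h1.symm
  have e3 : ∀ a : A, TensorProduct.lid k A
      ((ψ ∘ₗ LinearMap.mulLeft k (antipode k a)).rTensor A (comul (R := k) h)) = a := by
    intro a
    have h1 := lm ψ (antipode k a) 1 (comul (R := k) h)
    have h2 := lm' ψ a 1 (comul (R := k) h)
    rw [← one_eq, mul_one] at h1 h2
    rw [← aux_left h hleft, h2, hψ, hψh] at h1
    simpa using h1.symm
  have e4 : ∀ a : A, TensorProduct.lid k A
      ((ψ ∘ₗ LinearMap.mulRight k a).rTensor A (comul (R := k) h)) = antipode k a := by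
    intro a
    have h1 := lm ψ 1 a (comul (R := k) h)
    have h2 := lm' ψ 1 (antipode k a) (comul (R := k) h)
    rw [← one_eq, one_mul] at h1 h2
    rw [aux_right h hright, h2, hψ, hψh] at h1
    simpa using h1.symm
  intro a b
  constructor
  · obtain ⟨c, rfl⟩ := hS.2 b
    have h1 := sw (ψ ∘ₗ LinearMap.mulRight k c) (φ ∘ₗ LinearMap.mulLeft k a) (comul (R := k) h)
    have h2 := sw (ψ ∘ₗ LinearMap.mulRight k c)
      (φ ∘ₗ LinearMap.mulRight k (antipode k (antipode k a))) (comul (R := k) h)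
    rw [e1, e4] at h1
    rw [e2, e4] at h2
    simpa using h1.symm.trans h2
  · have hinv : ∀ x : A, antipode k (Function.invFun (antipode (R := k) (A := A)) x) = x :=
      Function.rightInverse_invFun hS.2
    set d := Function.invFun (antipode (R := k) (A := A)) a with hd
    set c := Function.invFun (antipode (R := k) (A := A)) d with hc
    have hdc : antipode k c = d := hinv d
    have had : antipode k d = a := hinv a
    have h1 := sw (ψ ∘ₗ LinearMap.mulLeft k (antipode k d))
      (φ ∘ₗ LinearMap.mulRight k (antipode k b)) (comul (R := k) h)
    have h2 := sw (ψ ∘ₗ LinearMap.mulRight k c)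
      (φ ∘ₗ LinearMap.mulRight k (antipode k b)) (comul (R := k) h)
    rw [e2, e3] at h1
    rw [e2, e4, hdc] at h2
    rw [had] at h1
    simpa using h1.trans h2.symm
end

section
/- Let A be a Hopf algebra over a field k whose antipode S is bijective, let h ∈ A be a nonzero element that is simultaneously a left cointegral and a right cointegral, and let φ : A → k be a left-invariant functional with φ(h) = 1. Define the modular element δ := (φ ⊗ id)(Δ(h)) ∈ A, the result of applying φ to the first tensor leg of Δ(h). Then a·δ = δ·S⁴(a) for all a ∈ A (Radford-type formula for the fourth power of the antipode). -/
open Coalgebra HopfAlgebra TensorProduct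

theorem aux_left_s14 {k A : Type*} [Field k] [Ring A] [HopfAlgebra k A] (a : A) :
    ∑ i ∈ (ℛ k a).index, (antipode k ((ℛ k a).left i) ⊗ₜ[k] (1 : A)) *
      comul (R := k) ((ℛ k a).right i) = (1 : A) ⊗ₜ[k] a := by
  have h1 := sum_tmul_tmul_eq (ℛ k a) (fun i => ℛ k ((ℛ k a).left i))
    (fun i => ℛ k ((ℛ k a).right i))
  have h2 := congrArg (((LinearMap.mul' k A).rTensor A ∘ₗ
    (TensorProduct.assoc k A A A).symm.toLinearMap) ∘ₗ (antipode k).rTensor (A ⊗[k] A)) h1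
  simp only [map_sum, LinearMap.comp_apply, LinearMap.rTensor_tmul, LinearEquiv.coe_coe,
    TensorProduct.assoc_symm_tmul, LinearMap.mul'_apply, ← TensorProduct.sum_tmul,
    sum_antipode_mul_eq_smul, TensorProduct.smul_tmul] at h2
  rw [← TensorProduct.tmul_sum, sum_counit_smul] at h2
  rw [h2]
  refine Finset.sum_congr rfl fun i _ => ?_
  conv_lhs => rw [← (ℛ k ((ℛ k a).right i)).eq]
  simp [Finset.mul_sum]

theorem aux_right_s14 {k A : Type*} [Field k] [Ring A] [HopfAlgebra k A] (a : A) :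
    ∑ i ∈ (ℛ k a).index, comul (R := k) ((ℛ k a).left i) *
      ((1 : A) ⊗ₜ[k] antipode k ((ℛ k a).right i)) = a ⊗ₜ[k] (1 : A) := by
  have h1 := sum_tmul_tmul_eq (ℛ k a) (fun i => ℛ k ((ℛ k a).left i))
    (fun i => ℛ k ((ℛ k a).right i))
  have h2 := congrArg ((LinearMap.mul' k A ∘ₗ (antipode k).lTensor A).lTensor A) h1
  simp only [map_sum, LinearMap.comp_apply, LinearMap.lTensor_tmul,
    LinearMap.mul'_apply, ← TensorProduct.tmul_sum,
    sum_mul_antipode_eq_smul, ← TensorProduct.smul_tmul] at h2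
  have h3 : ∑ i ∈ (ℛ k a).index, counit (R := k) ((ℛ k a).right i) • (ℛ k a).left i = a := by
    simpa only [map_sum, TensorProduct.rid_tmul, one_smul] using
      congrArg (TensorProduct.rid k A) (sum_tmul_counit_eq (ℛ k a))
  rw [← TensorProduct.sum_tmul, h3] at h2
  rw [← h2]
  refine Finset.sum_congr rfl fun i _ => ?_
  conv_lhs => rw [← (ℛ k ((ℛ k a).left i)).eq]
  simp [Finset.sum_mul]

theorem coint_left {k A : Type*} [Field k] [Ring A] [HopfAlgebra k A] (h : A)
    (hleft : ∀ a : A, a * h = counit (R := k) a • h) (a : A) :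
    ((1 : A) ⊗ₜ[k] a) * comul (R := k) h = (antipode k a ⊗ₜ[k] (1 : A)) * comul (R := k) h := by
  rw [← aux_left_s14, Finset.sum_mul]
  simp_rw [mul_assoc, ← Bialgebra.comul_mul, hleft, map_smul, mul_smul_comm, ← smul_mul_assoc]
  rw [← Finset.sum_mul]
  congr 1
  have h3 : ∑ i ∈ (ℛ k a).index, counit (R := k) ((ℛ k a).right i) • (ℛ k a).left i = a := by
    simpa only [map_sum, TensorProduct.rid_tmul, one_smul] using
      congrArg (TensorProduct.rid k A) (sum_tmul_counit_eq (ℛ k a))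
  conv_rhs => rw [← h3]
  simp [TensorProduct.sum_tmul, TensorProduct.smul_tmul']

theorem coint_right {k A : Type*} [Field k] [Ring A] [HopfAlgebra k A] (h : A)
    (hright : ∀ a : A, h * a = counit (R := k) a • h) (a : A) :
    comul (R := k) h * (a ⊗ₜ[k] (1 : A)) = comul (R := k) h * ((1 : A) ⊗ₜ[k] antipode k a) := by
  rw [← aux_right_s14, Finset.mul_sum]
  simp_rw [← mul_assoc, ← Bialgebra.comul_mul, hright, map_smul, smul_mul_assoc, ← mul_smul_comm]
  rw [← Finset.mul_sum]
  congr 1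
  conv_rhs => rw [← sum_counit_smul (ℛ k a)]
  simp [TensorProduct.tmul_sum]

/-- If the antipode `S` of a Hopf algebra `A` over a field `k` is bijective,
`h` is a nonzero two-sided cointegral, and `φ` is left invariant with `φ h = 1`, then the
modular element `δ = (φ ⊗ id)(Δ(h))` satisfies `a·δ = δ·S⁴(a)` for all `a`. -/
theorem stmt14 {k A : Type*} [Field k] [Ring A] [HopfAlgebra k A]
    (hS : Function.Bijective (antipode (R := k) (A := A)))
    (h : A) (hh : h ≠ 0)
    (hleft : ∀ a : A, a * h = counit (R := k) a • h)
    (hright : ∀ a : A, h * a = counit (R := k) a • h)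
    (φ : A →ₗ[k] k) (hφh : φ h = 1)
    (hφ : ∀ a : A,
      (TensorProduct.rid k A) ((LinearMap.lTensor A φ) (comul (R := k) a)) = φ a • (1 : A))
    (δ : A)
    (hδ : δ = (TensorProduct.lid k A) ((LinearMap.rTensor A φ) (comul (R := k) h))) :
    ∀ a : A, a * δ =
      δ * antipode (R := k) (antipode (R := k) (antipode (R := k) (antipode (R := k) a))) := by
  have hL := coint_left (k := k) h hleft
  have hR := coint_right (k := k) h hright
  have h1 := hφ h
  rw [hφh, one_smul] at h1
  obtain ⟨I, hI⟩ : ∃ I : Finset (A × A), comul (R := k) h = ∑ i ∈ I, i.1 ⊗ₜ[k] i.2 :=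
    TensorProduct.exists_finset _
  rw [hI] at hL hR h1 hδ
  simp only [map_sum, LinearMap.lTensor_tmul, LinearMap.rTensor_tmul, TensorProduct.rid_tmul,
    TensorProduct.lid_tmul, Finset.mul_sum, Finset.sum_mul, Algebra.TensorProduct.tmul_mul_tmul,
    one_mul, mul_one] at hL hR h1 hδ
  -- S(b) = h1 φ(b h2)
  have e1 : ∀ b : A, ∑ i ∈ I, φ (b * i.2) • i.1 = antipode k b := by
    intro b
    have := congrArg (fun t => TensorProduct.rid k A (LinearMap.lTensor A φ t)) (hL b)
    simp only [map_sum, LinearMap.lTensor_tmul, TensorProduct.rid_tmul] at this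
    rw [this]
    simp_rw [← mul_smul_comm]
    rw [← Finset.mul_sum, h1, mul_one]
  -- b = h1 φ(h2 S b)
  have e2 : ∀ b : A, ∑ i ∈ I, φ (i.2 * antipode k b) • i.1 = b := by
    intro b
    have := congrArg (fun t => TensorProduct.rid k A (LinearMap.lTensor A φ t)) (hR b)
    simp only [map_sum, LinearMap.lTensor_tmul, TensorProduct.rid_tmul] at this
    rw [← this]
    simp_rw [← smul_mul_assoc]
    rw [← Finset.sum_mul, h1, one_mul]
  let T : Module.Dual k A →ₗ[k] A :=
    ∑ i ∈ I, (LinearMap.applyₗ (R := k) (M₂ := k) i.2).smulRight i.1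
  have hT : ∀ f : Module.Dual k A, T f = ∑ i ∈ I, f i.2 • i.1 := by
    intro f; simp [T]
  have hTs : Function.Surjective T := by
    intro b
    refine ⟨φ ∘ₗ LinearMap.mulRight k (antipode k b), ?_⟩
    rw [hT]; simpa using e2 b
  have hfin : Module.Finite k A := by
    classical
    refine ⟨⟨I.image Prod.fst, ?_⟩⟩
    rw [eq_top_iff]
    intro b _
    rw [← e2 b]
    refine Submodule.sum_mem _ fun i hi => Submodule.smul_mem _ _ (Submodule.subset_span ?_)
    exact Finset.mem_coe.2 (Finset.mem_image_of_mem _ hi)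
  have hTi : Function.Injective T :=
    (LinearMap.injective_iff_surjective_of_finrank_eq_finrank
      (Subspace.dual_finrank_eq)).2 hTs
  have nak : ∀ b x : A, φ (b * x) = φ (x * antipode k (antipode k b)) := by
    intro b x
    have : φ ∘ₗ LinearMap.mulLeft k b =
        φ ∘ₗ LinearMap.mulRight k (antipode k (antipode k b)) := by
      apply hTi
      rw [hT, hT]
      simpa [e1] using (e2 (antipode k b)).symm
    simpa using LinearMap.congr_fun this x
  intro a
  have l1 := congrArg (fun t => TensorProduct.lid k A (LinearMap.rTensor A φ t)) (hL a)
  have l2 := congrArg (fun t => TensorProduct.lid k A (LinearMap.rTensor A φ t))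
    (hR (antipode k (antipode k (antipode k a))))
  simp only [map_sum, LinearMap.rTensor_tmul, TensorProduct.lid_tmul] at l1 l2
  simp_rw [← nak] at l2
  rw [← l1] at l2
  rw [hδ, Finset.mul_sum, Finset.sum_mul]
  simp_rw [mul_smul_comm, smul_mul_assoc]
  exact l2
end
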